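/- Let K be a field, A a 3×3 matrix over K, and σ₁ : M₃(K) → K a K-linear functional with σ₁(Id) = 0 and σ₁(A) ≠ 0. Set s₂ = σ₁(A)·tr(A) − σ₁(A²). Then for every integer k ≥ 1, tr(Sym^k A) = (1/σ₁(A)) · Σ_{i=0}^{k−2} (s₂/σ₁(A))^i · σ₁(A^{k+1−i}) + (s₂/σ₁(A))^{k−1} · (σ₁(A²) + s₂)/σ₁(A). -/

import Mathlib

open MvPolynomial Finset

/-- The endomorphism induced by the matrix `A` on the space of homogeneous polynomials of
degree `k` in `n` variables (a model for the `k`-th symmetric power of `K^n`). -/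
noncomputable def symPowMap {K : Type*} [Field K] {n : ℕ} (A : Matrix (Fin n) (Fin n) K) (k : ℕ) :
    homogeneousSubmodule (Fin n) K k →ₗ[K] homogeneousSubmodule (Fin n) K k :=
  LinearMap.restrict
    (MvPolynomial.aeval fun i => ∑ j, A i j • X j :
      MvPolynomial (Fin n) K →ₐ[K] MvPolynomial (Fin n) K).toLinearMap
    (fun p hp => by
      rw [mem_homogeneousSubmodule] at hp ⊢
      have hg : ∀ i : Fin n, (∑ j, A i j • X j : MvPolynomial (Fin n) K).IsHomogeneous 1 := by
        intro i
        apply IsHomogeneous.sum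
        intro j _
        rw [smul_eq_C_mul]
        exact (isHomogeneous_X K j).C_mul (A i j)
      have := hp.aeval (fun i => ∑ j, A i j • X j) hg
      simpa using this)

/-- `trSymPow A k = tr(Sym^k A)`, the trace of the `k`-th symmetric power of `A`. -/
noncomputable def trSymPow {K : Type*} [Field K] {n : ℕ} (A : Matrix (Fin n) (Fin n) K)
    (k : ℕ) : K :=
  LinearMap.trace K _ (symPowMap A k)

/-- `tr(Sym^k A)` for an integer index, with the convention `tr(Sym^k A) = 0` for `k < 0`. -/
noncomputable def trSymPowZ {K : Type*} [Field K] {n : ℕ} (A : Matrix (Fin n) (Fin n) K)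
    (k : ℤ) : K :=
  if 0 ≤ k then trSymPow A k.toNat else 0

/-- Over an algebraically closed field, every endomorphism of a finite-dimensional space is upper
triangular in some basis. -/
theorem Module.End.exists_basis_repr_apply_eq_zero_of_lt {K : Type*} [Field K] [IsAlgClosed K]
    (n : ℕ) :
    ∀ {V : Type*} [AddCommGroup V] [Module K V] [FiniteDimensional K V]
      (_ : Module.finrank K V = n) (f : Module.End K V),
      ∃ b : Module.Basis (Fin n) K V, ∀ i j, j < i → b.repr (f (b j)) i = 0 := by
  induction n with
  | zero =>
    intro V _ _ _ hV f
    exact ⟨Module.finBasisOfFinrankEq K V hV, fun i => i.elim0⟩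
  | succ n ih =>
    intro V _ _ _ hV f
    have : Nontrivial V := Module.nontrivial_of_finrank_pos (R := K) (by omega)
    obtain ⟨μ, hμ⟩ := f.exists_eigenvalue
    have hrange : LinearMap.range (f - algebraMap K (Module.End K V) μ) < ⊤ := by
      rw [lt_top_iff_ne_top, Ne, LinearMap.range_eq_top, ← LinearMap.injective_iff_surjective,
        ← LinearMap.ker_eq_bot]
      rw [Module.End.hasEigenvalue_iff, Module.End.eigenspace_def] at hμ
      exact hμ
    obtain ⟨φ, hφ, hle⟩ := Submodule.exists_le_ker_of_lt_top _ hrange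
    have hφf : ∀ v, φ (f v) = μ * φ v := fun v => by
      have := hle ⟨v, rfl⟩
      simpa [sub_eq_zero] using this
    have hmaps : ∀ v ∈ LinearMap.ker φ, f v ∈ LinearMap.ker φ := fun v hv => by
      rw [LinearMap.mem_ker] at hv ⊢
      rw [hφf, hv, mul_zero]
    have hker : Module.finrank K (LinearMap.ker φ) = n := by
      have := Module.Dual.finrank_ker_add_one_of_ne_zero hφ
      omega
    obtain ⟨b, hb⟩ := ih hker (f.restrict hmaps)
    obtain ⟨y, hy⟩ := (LinearMap.surjective hφ) 1
    let bV : Module.Basis (Fin (n + 1)) K V := Module.Basis.mkFinSnoc b y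
      (fun c x hx h => by
        have := congrArg φ h
        simpa [LinearMap.mem_ker.mp hx, hy] using this)
      (fun z => ⟨-φ z, by simp [hy]⟩)
    have hbV : ⇑bV = Fin.snoc ((LinearMap.ker φ).subtype ∘ b) y := Module.Basis.coe_mkFinSnoc ..
    have hrepr : ∀ w : LinearMap.ker φ, ∀ i,
        bV.repr w i = Fin.snoc (α := fun _ => K) (b.repr w) 0 i := fun w i => by
      have hw : (w : V) = ∑ j, (Fin.snoc (b.repr w) 0 : Fin (n + 1) → K) j • bV j := by
        conv_lhs => rw [← b.sum_repr w]
        simp only [Fin.sum_univ_castSucc, hbV, Fin.snoc_castSucc, Fin.snoc_last, zero_smul,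
          add_zero, Submodule.coe_sum, Submodule.coe_smul, Function.comp_apply,
          Submodule.subtype_apply]
      rw [hw, bV.repr_sum_self]
    refine ⟨bV, fun i j hij => ?_⟩
    obtain ⟨j, rfl⟩ := Fin.exists_castSucc_eq.mpr (hij.trans_le (Fin.le_last i)).ne
    have hfb : f (bV j.castSucc) = f.restrict hmaps (b j) := by simp [hbV]
    rw [hfb, hrepr]
    cases i using Fin.lastCases with
    | last => simp
    | cast i => simpa using hb i j (by simpa using hij)

theorem Matrix.exists_units_conj_isUpperTriangular {K : Type*} [Field K] [IsAlgClosed K] {n : ℕ}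
    (A : Matrix (Fin n) (Fin n) K) :
    ∃ P : (Matrix (Fin n) (Fin n) K)ˣ, (P.val * A * P⁻¹.val).IsUpperTriangular := by
  obtain ⟨b, hb⟩ := Module.End.exists_basis_repr_apply_eq_zero_of_lt n (by simp) A.toLin'
  refine ⟨⟨b.toMatrix (Pi.basisFun K _), (Pi.basisFun K _).toMatrix b, by simp, by simp⟩, ?_⟩
  intro i j hij
  have := basis_toMatrix_mul_linearMap_toMatrix_mul_basis_toMatrix b (Pi.basisFun K (Fin n))
    b (Pi.basisFun K (Fin n)) A.toLin'
  rw [LinearMap.toMatrix_eq_toMatrix', LinearMap.toMatrix'_toLin'] at this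
  change (b.toMatrix (Pi.basisFun K _) * A * (Pi.basisFun K _).toMatrix b) i j = 0
  rw [this, LinearMap.toMatrix_apply]
  exact hb i j hij

theorem prod_one_sub_mul_mk_sum_finsuppAntidiag {ι R : Type*} [Fintype ι] [DecidableEq ι]
    [CommRing R] (t : ι → R) :
    (∏ i, (1 - PowerSeries.C (t i) * PowerSeries.X)) *
      PowerSeries.mk (fun k => ∑ m ∈ finsuppAntidiag (univ : Finset ι) k, ∏ i, t i ^ m i) = 1 := by
  have h : PowerSeries.mk (fun k => ∑ m ∈ finsuppAntidiag (univ : Finset ι) k, ∏ i, t i ^ m i) =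
      ∏ i, PowerSeries.mk (fun k => t i ^ k) := by
    ext k
    simp [PowerSeries.coeff_prod]
  rw [h, ← prod_mul_distrib]
  refine prod_eq_one fun i _ => ?_
  ext k
  rw [sub_mul, one_mul, mul_assoc]
  cases k <;> simp [PowerSeries.coeff_succ_X_mul, pow_succ', PowerSeries.coeff_one]

section Trace

variable {K : Type*} [Field K] {n : ℕ}

theorem symPowMap_apply_coe (A : Matrix (Fin n) (Fin n) K) (k : ℕ)
    (p : homogeneousSubmodule (Fin n) K k) :
    (symPowMap A k p : MvPolynomial (Fin n) K) =
      aeval (fun i => ∑ j, A i j • X j) (p : MvPolynomial (Fin n) K) :=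
  rfl

theorem symPowMap_mul (A B : Matrix (Fin n) (Fin n) K) (k : ℕ) :
    symPowMap (A * B) k = symPowMap B k * symPowMap A k := by
  ext p : 2
  rw [Module.End.mul_apply, symPowMap_apply_coe, symPowMap_apply_coe, symPowMap_apply_coe,
    ← AlgHom.comp_apply]
  congr 1
  refine algHom_ext fun i => ?_
  simp only [AlgHom.comp_apply, aeval_X, map_sum, map_smul, Matrix.mul_apply, sum_smul, smul_sum,
    smul_smul]
  exact sum_comm

theorem trSymPow_mul_comm (A B : Matrix (Fin n) (Fin n) K) (k : ℕ) :
    trSymPow (A * B) k = trSymPow (B * A) k := by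
  rw [trSymPow, trSymPow, symPowMap_mul, symPowMap_mul, LinearMap.trace_mul_comm]

theorem trSymPow_units_conj (P : (Matrix (Fin n) (Fin n) K)ˣ) (A : Matrix (Fin n) (Fin n) K)
    (k : ℕ) : trSymPow (P.val * A * P⁻¹.val) k = trSymPow A k := by
  rw [trSymPow_mul_comm, ← mul_assoc, Units.inv_mul, one_mul]

theorem trSymPow_eq_sum_coeff (A : Matrix (Fin n) (Fin n) K) (k : ℕ) :
    trSymPow A k = ∑ m ∈ finsuppAntidiag (univ : Finset (Fin n)) k,
      coeff m (∏ i, (∑ j, A i j • X j : MvPolynomial (Fin n) K) ^ m i) := by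
  classical
  have hmem : ∀ m : Fin n →₀ ℕ, m ∈ finsuppAntidiag (univ : Finset (Fin n)) k ↔
      m.degree = k := fun m => by
    simp [Finsupp.degree_eq_sum]
  obtain ⟨b, hrepr⟩ : ∃ b : Module.Basis (finsuppAntidiag (univ : Finset (Fin n)) k) K
      (homogeneousSubmodule (Fin n) K k),
      ∀ p m, b.repr p m = coeff (m : Fin n →₀ ℕ) (p : MvPolynomial (Fin n) K) :=
    ⟨((basisRestrictSupport K {d : Fin n →₀ ℕ | d.degree = k}).map
      (LinearEquiv.ofEq _ _ (homogeneousSubmodule_eq_finsupp_supported (Fin n) K k).symm)).reindex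
      (Equiv.subtypeEquivRight hmem).symm, fun p m => rfl⟩
  have hb : ∀ m, (b m : MvPolynomial (Fin n) K) = monomial (m : Fin n →₀ ℕ) 1 := fun m => by
    have hm : b m = ⟨monomial (m : Fin n →₀ ℕ) 1,
        (mem_homogeneousSubmodule k _).mpr (isHomogeneous_monomial 1 ((hmem m).mp m.2))⟩ := by
      refine b.repr.injective (Finsupp.ext fun d => ?_)
      rw [b.repr_self, hrepr, coeff_monomial, Finsupp.single_apply]
      simp only [Subtype.ext_iff]
    rw [hm]
  have htrace : trSymPow A k = ∑ m, b.repr (symPowMap A k (b m)) m := by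
    rw [trSymPow, LinearMap.trace_eq_matrix_trace K b]
    simp only [Matrix.trace, Matrix.diag_apply, LinearMap.toMatrix_apply]
  rw [htrace, ← sum_coe_sort (finsuppAntidiag (univ : Finset (Fin n)) k)]
  refine sum_congr rfl fun m _ => ?_
  rw [hrepr, symPowMap_apply_coe, hb, aeval_monomial, map_one, one_mul,
    Finsupp.prod_fintype _ _ (by simp)]

theorem trSymPow_map {L : Type*} [Field L] (f : K →+* L) (A : Matrix (Fin n) (Fin n) K) (k : ℕ) :
    trSymPow (A.map f) k = f (trSymPow A k) := by
  simp only [trSymPow_eq_sum_coeff, map_sum]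
  refine sum_congr rfl fun m _ => ?_
  rw [← coeff_map]
  simp [smul_eq_C_mul]

theorem MonomialOrder.degree_pow_le_and_coeff {σ R : Type*} [CommSemiring R]
    (m : MonomialOrder σ) {f : MvPolynomial σ R}
    {a : σ →₀ ℕ} (h : m.toSyn (m.degree f) ≤ m.toSyn a) (e : ℕ) :
    m.toSyn (m.degree (f ^ e)) ≤ m.toSyn (e • a) ∧ coeff (e • a) (f ^ e) = coeff a f ^ e := by
  induction e with
  | zero => simp
  | succ e ih =>
    rw [pow_succ, succ_nsmul, pow_succ]
    refine ⟨m.degree_mul_le.trans ?_, ?_⟩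
    · rw [map_add, map_add]
      exact add_le_add ih.1 h
    · rw [m.coeff_mul_of_add_of_degree_le ih.1 h, ih.2]

theorem MonomialOrder.coeff_prod_of_degree_le {σ R ι : Type*} [CommSemiring R]
    (m : MonomialOrder σ) (s : Finset ι)
    {f : ι → MvPolynomial σ R} {a : ι → σ →₀ ℕ}
    (h : ∀ i ∈ s, m.toSyn (m.degree (f i)) ≤ m.toSyn (a i)) :
    coeff (∑ i ∈ s, a i) (∏ i ∈ s, f i) = ∏ i ∈ s, coeff (a i) (f i) := by
  classical
  induction s using Finset.induction_on with
  | empty => simp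
  | insert i s his ih =>
    have hs : ∀ j ∈ s, m.toSyn (m.degree (f j)) ≤ m.toSyn (a j) :=
      fun j hj => h j (mem_insert_of_mem hj)
    rw [prod_insert his, sum_insert his, prod_insert his, m.coeff_mul_of_add_of_degree_le
      (h i (mem_insert_self i s)), ih hs]
    refine m.degree_prod_le.trans ?_
    rw [map_sum, map_sum]
    exact sum_le_sum hs

theorem trSymPow_of_isUpperTriangular {A : Matrix (Fin n) (Fin n) K} (hA : A.IsUpperTriangular)
    (k : ℕ) :
    trSymPow A k = ∑ m ∈ finsuppAntidiag (univ : Finset (Fin n)) k, ∏ i, A i i ^ m i := by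
  rw [trSymPow_eq_sum_coeff]
  refine sum_congr rfl fun m _ => ?_
  let o : MonomialOrder (Fin n) := MonomialOrder.lex
  have hdeg : ∀ i, o.toSyn (o.degree (∑ j, A i j • X j : MvPolynomial (Fin n) K)) ≤
      o.toSyn (Finsupp.single i 1) := fun i => by
    refine o.degree_sum_le.trans (Finset.sup_le fun j _ => ?_)
    rcases lt_or_ge j i with hij | hij
    · simp [hA hij]
    · refine o.degree_smul_le.trans (o.degree_X_le_single.trans ?_)
      exact MonomialOrder.lex_le_iff.mpr (Finsupp.Lex.single_le_iff.mpr hij)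
  have hcoeff : ∀ i, coeff (Finsupp.single i 1)
      (∑ j, A i j • X j : MvPolynomial (Fin n) K) = A i i := fun i => by
    simp [coeff_sum, coeff_X, Finsupp.single_left_inj]
  have key := o.coeff_prod_of_degree_le univ (a := fun i => m i • Finsupp.single i 1)
    fun i _ => (o.degree_pow_le_and_coeff (hdeg i) (m i)).1
  have hm : ∑ i, m i • Finsupp.single i 1 = m := by simp
  rw [hm] at key
  rw [key]
  exact prod_congr rfl fun i _ => by rw [(o.degree_pow_le_and_coeff (hdeg i) (m i)).2, hcoeff]

end Trace

theorem Matrix.charpolyRev_map {ι R S : Type*} [Fintype ι] [DecidableEq ι] [CommRing R] [CommRing S]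
    (A : Matrix ι ι R) (f : R →+* S) : (A.map f).charpolyRev = A.charpolyRev.map f := by
  rw [charpolyRev, charpolyRev, ← Polynomial.coe_mapRingHom, RingHom.map_det]
  congr 1
  ext i j : 1
  by_cases h : i = j <;> simp [h]

theorem Matrix.charpolyRev_of_isUpperTriangular {ι R : Type*} [Fintype ι] [LinearOrder ι]
    [CommRing R] {T : Matrix ι ι R} (hT : T.IsUpperTriangular) :
    T.charpolyRev = ∏ i, (1 - Polynomial.C (T i i) * Polynomial.X) := by
  rw [charpolyRev, det_of_isUpperTriangular]
  · refine prod_congr rfl fun i _ => ?_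
    rw [sub_apply, one_apply_eq, smul_apply, map_apply, smul_eq_mul, mul_comm]
  · intro i j hij
    rw [sub_apply, one_apply_ne (i := i) (j := j) (ne_of_gt hij), smul_apply, map_apply,
      hT hij, map_zero, smul_zero, sub_zero]

/-- The generating function of the traces of the symmetric powers of `A` is the inverse of
`det (1 - X A)`. -/
theorem charpolyRev_mul_mk_trSymPow {K : Type*} [Field K] {n : ℕ} (A : Matrix (Fin n) (Fin n) K) :
    (A.charpolyRev : PowerSeries K) * PowerSeries.mk (trSymPow A) = 1 := by
  let f := algebraMap K (AlgebraicClosure K)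
  obtain ⟨P, hP⟩ := (A.map f).exists_units_conj_isUpperTriangular
  set T := P.val * A.map f * P⁻¹.val with hT
  have hdet : A.charpolyRev.map f = ∏ i, (1 - Polynomial.C (T i i) * Polynomial.X) := by
    rw [← Matrix.charpolyRev_map, ← Matrix.reverse_charpoly,
      ← Matrix.charpoly_units_conj P, ← Matrix.coe_units_inv, ← hT, Matrix.reverse_charpoly,
      Matrix.charpolyRev_of_isUpperTriangular hP]
  have htr : ∀ k, f (trSymPow A k) =
      ∑ m ∈ finsuppAntidiag (univ : Finset (Fin n)) k, ∏ i, T i i ^ m i := fun k => by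
    rw [← trSymPow_map, ← trSymPow_units_conj P, ← hT, trSymPow_of_isUpperTriangular hP]
  apply PowerSeries.map_injective f f.injective
  rw [map_mul, map_one, ← Polynomial.polynomial_map_coe, hdet]
  rw [← prod_one_sub_mul_mk_sum_finsuppAntidiag fun i => T i i]
  congr 1
  · rw [← Polynomial.coeToPowerSeries.ringHom_apply, map_prod]
    simp
  · ext k
    simp [htr]

/-- The reversed characteristic polynomial of a 3 × 3 matrix, together with Cayley–Hamilton. -/
theorem Matrix.exists_charpolyRev_fin_three {R : Type*} [CommRing R] (A : Matrix (Fin 3) (Fin 3) R) :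
    ∃ e : R, A.charpolyRev = 1 - Polynomial.C A.trace * Polynomial.X +
        Polynomial.C e * Polynomial.X ^ 2 - Polynomial.C A.det * Polynomial.X ^ 3 ∧
      A ^ 3 = A.trace • A ^ 2 - e • A + A.det • 1 := by
  refine ⟨A 0 0 * A 1 1 - A 0 1 * A 1 0 + (A 0 0 * A 2 2 - A 0 2 * A 2 0) +
    (A 1 1 * A 2 2 - A 1 2 * A 2 1), ?_, ?_⟩
  · rw [Matrix.charpolyRev, Matrix.det_fin_three, Matrix.det_fin_three, Matrix.trace_fin_three]
    simp
    ring
  · ext i j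
    fin_cases i <;> fin_cases j <;>
      simp [pow_succ, Matrix.mul_apply, Fin.sum_univ_three, Matrix.det_fin_three,
        Matrix.trace_fin_three] <;>
      ring

theorem trSymPow_recurrence_fin_three {K : Type*} [Field K] (A : Matrix (Fin 3) (Fin 3) K) :
    ∃ e : K, trSymPow A 0 = 1 ∧ trSymPow A 1 = A.trace ∧
      trSymPow A 2 = A.trace * trSymPow A 1 - e ∧
      (∀ k, trSymPow A (k + 3) =
        A.trace * trSymPow A (k + 2) - e * trSymPow A (k + 1) + A.det * trSymPow A k) ∧
      A ^ 3 = A.trace • A ^ 2 - e • A + A.det • 1 := by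
  obtain ⟨e, hrev, hpow⟩ := A.exists_charpolyRev_fin_three
  have h := charpolyRev_mul_mk_trSymPow A
  rw [hrev] at h
  simp only [Polynomial.coe_add, Polynomial.coe_sub, Polynomial.coe_mul, Polynomial.coe_one,
    Polynomial.coe_C, Polynomial.coe_X, Polynomial.coe_pow, sub_mul, add_mul, one_mul, mul_assoc]
    at h
  have hc := fun k => congrArg (PowerSeries.coeff k) h
  simp only [map_add, map_sub, PowerSeries.coeff_C_mul, PowerSeries.coeff_mk,
    PowerSeries.coeff_X_pow_mul', PowerSeries.coeff_one] at hc
  have h0 := hc 0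
  have h1 := hc 1
  have h2 := hc 2
  simp at h0
  simp [PowerSeries.coeff_succ_X_mul, h0] at h1
  simp [PowerSeries.coeff_succ_X_mul, h0, show (2 : ℕ) = 1 + 1 from rfl] at h2
  refine ⟨e, h0, by linear_combination h1, by linear_combination h2, fun k => ?_, hpow⟩
  have h3 := hc (k + 3)
  simp [PowerSeries.coeff_succ_X_mul] at h3
  linear_combination h3

theorem map_pow_eq_trSymPow_fin_three {K : Type*} [Field K] (A : Matrix (Fin 3) (Fin 3) K)
    (σ : Matrix (Fin 3) (Fin 3) K →ₗ[K] K) (hσ : σ 1 = 0) (k : ℕ) :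
    σ (A ^ (k + 2)) =
      σ A * trSymPow A (k + 1) - (σ A * A.trace - σ (A ^ 2)) * trSymPow A k := by
  obtain ⟨e, h0, h1, h2, hrec, hpow⟩ := trSymPow_recurrence_fin_three A
  have ha : ∀ k, σ (A ^ (k + 3)) =
      A.trace * σ (A ^ (k + 2)) - e * σ (A ^ (k + 1)) + A.det * σ (A ^ k) := fun k => by
    rw [pow_add, hpow]
    simp [mul_add, mul_sub, ← pow_add, ← pow_succ]
  have a3 := ha 0
  have a4 := ha 1
  have h3 := hrec 0
  simp only [zero_add, pow_zero, pow_one, hσ, Nat.reduceAdd] at a3 a4 h3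
  induction k using Nat.strong_induction_on with
  | _ k ih =>
    match k with
    | 0 => simp only [zero_add, h0, h1]; ring
    | 1 => simp only [Nat.reduceAdd, a3, h2, h1]; ring
    | 2 => simp only [Nat.reduceAdd, a4, a3, h3, h2, h1, h0]; ring
    | k + 3 =>
      have i0 := ih k (by omega)
      have i1 := ih (k + 1) (by omega)
      have i2 := ih (k + 2) (by omega)
      have ak := ha (k + 2)
      have r0 := hrec k
      have r1 := hrec (k + 1)
      simp only [add_assoc, Nat.reduceAdd] at *
      rw [ak, r0, r1, i0, i1, i2, r0]
      ring

theorem sym_trace_three_by_three_formula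
    (K : Type*) [Field K] (A : Matrix (Fin 3) (Fin 3) K)
    (σ₁ : Matrix (Fin 3) (Fin 3) K →ₗ[K] K) (hId : σ₁ 1 = 0) (hA : σ₁ A ≠ 0)
    (s₂ : K) (hs₂ : s₂ = σ₁ A * A.trace - σ₁ (A ^ 2)) :
    ∀ k : ℕ, 1 ≤ k →
      trSymPow A k =
        (σ₁ A)⁻¹ * (∑ i ∈ Finset.range (k - 1), (s₂ / σ₁ A) ^ i * σ₁ (A ^ (k + 1 - i)))
          + (s₂ / σ₁ A) ^ (k - 1) * ((σ₁ (A ^ 2) + s₂) / σ₁ A) := by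
  have hstep : ∀ k, trSymPow A (k + 1) =
      (σ₁ A)⁻¹ * σ₁ (A ^ (k + 2)) + s₂ / σ₁ A * trSymPow A k := fun k => by
    rw [map_pow_eq_trSymPow_fin_three A σ₁ hId, ← hs₂]
    field_simp
    ring
  intro k hk
  induction k, hk using Nat.le_induction with
  | base =>
    obtain ⟨-, h0, -⟩ := trSymPow_recurrence_fin_three A
    rw [hstep, h0]
    simp
    field_simp
  | succ k hk ih =>
    obtain ⟨k, rfl⟩ := Nat.exists_eq_add_of_le' hk
    rw [hstep, ih]
    simp only [Nat.add_sub_cancel, sum_range_succ' _ k, pow_zero, one_mul, Nat.sub_zero, pow_succ',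
      Nat.add_sub_add_right, mul_assoc, ← mul_sum]
    ring
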